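/- arXiv:0707.3862 — 2 statements merged into one kernel-verified Lean document; each statement's English description precedes it below -/
import Mathlib

section
/- Let a and b be odd nonnegative integers, set c = (a+b)/2 and d = ⌊a/2⌋ = (a−1)/2, and let u be a real number. Then sin^a u · cos^b u = ((−1)^d / 2^{a+b}) · Σ_{j=1}^{c} ( T_{c+j}(a,b) − T_{c−j}(a,b) ) · sin(2ju). -/
/-- `T_x(a,b) = Σ_{j=0}^{x} (−1)^{a−x+j} C(a, x−j) C(b, j)`, where the sign exponent
`a−x+j` is computed in `ℤ` and `C(n,k) = 0` for `k > n` (and for `x−j` this is the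
truncated natural subtraction, matching the convention `C(n,k) = 0` for `k < 0`). -/
noncomputable def T (x a b : ℕ) : ℝ :=
  ∑ j ∈ Finset.range (x + 1),
    (-1 : ℝ) ^ ((a : ℤ) - (x : ℤ) + (j : ℤ)) * (a.choose (x - j)) * (b.choose j)


open Polynomial in
theorem coeff_X_add_one_pow_mul_X_add_C_neg_one_pow (x a b : ℕ) :
    ((X + 1 : ℝ[X]) ^ b * (X + C (-1)) ^ a).coeff x = T x a b := by
  rw [coeff_mul, Finset.Nat.sum_antidiagonal_eq_sum_range_succ_mk, T]
  refine Finset.sum_congr rfl fun j hj => ?_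
  have hj : j ≤ x := Nat.lt_succ_iff.mp (Finset.mem_range.mp hj)
  simp only [coeff_X_add_one_pow, coeff_X_add_C_pow]
  rcases le_or_gt (x - j) a with h | h
  · have e : (a : ℤ) - x + j = ((a - (x - j) : ℕ) : ℤ) := by omega
    rw [e, zpow_natCast]
    ring
  · simp [Nat.choose_eq_zero_of_lt h]

open Polynomial in
/-- The generating function of `x ↦ T x a b`. -/
theorem sum_T_mul_pow (a b : ℕ) (z : ℂ) :
    ∑ x ∈ Finset.range (a + b + 1), (T x a b : ℂ) * z ^ x = (z + 1) ^ b * (z - 1) ^ a := by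
  have hdeg : ((X + 1 : ℝ[X]) ^ b * (X + C (-1)) ^ a).natDegree < a + b + 1 := by
    have : ((X + 1 : ℝ[X]) ^ b * (X + C (-1)) ^ a).natDegree ≤ b * 1 + a * 1 := by
      refine natDegree_mul_le_of_le (natDegree_pow_le_of_le _ ?_) (natDegree_pow_le_of_le _ ?_)
      · exact (natDegree_X_add_C (1 : ℝ)).le
      · exact (natDegree_X_add_C (-1 : ℝ)).le
    omega
  have h := aeval_eq_sum_range' hdeg z
  simp only [coeff_X_add_one_pow_mul_X_add_C_neg_one_pow, Complex.real_smul] at h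
  rw [← h]
  simp [sub_eq_add_neg]

theorem sum_range_two_mul_add_one {M : Type*} [AddCommMonoid M] (f : ℕ → M) (c : ℕ) :
    ∑ x ∈ Finset.range (2 * c + 1), f x =
      f c + ∑ j ∈ Finset.Icc 1 c, (f (c + j) + f (c - j)) := by
  have hIcc : Finset.Icc 1 c = Finset.Ico 1 (c + 1) := by ext; simp
  rw [show 2 * c + 1 = c + (c + 1) by ring, Finset.sum_range_add, Finset.sum_range_succ',
    ← Finset.sum_range_reflect, hIcc, Finset.sum_Ico_eq_sum_range, Finset.sum_add_distrib]
  simp only [Nat.add_sub_cancel, Nat.add_zero, Nat.add_comm 1, Nat.sub_sub]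
  abel

/-- The Fourier expansion of `sin ^ a * cos ^ b` in exponential form. -/
theorem I_pow_mul_sin_pow_mul_cos_pow (a b c : ℕ) (hc : a + b = 2 * c) (u : ℝ) :
    Complex.I ^ a * ((2 ^ (a + b) * (Real.sin u ^ a * Real.cos u ^ b) : ℝ) : ℂ) =
      ∑ x ∈ Finset.range (2 * c + 1),
        (T x a b : ℂ) * Complex.exp ((2 * ((x : ℝ) - c) * u : ℝ) * Complex.I) := by
  have hsin : Complex.exp (u * Complex.I) ^ 2 - 1 =
      2 * Complex.I * Complex.sin u * Complex.exp (u * Complex.I) := by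
    rw [Complex.exp_mul_I]
    linear_combination Complex.sin_sq_add_cos_sq (u : ℂ) - Complex.sin u ^ 2 * Complex.I_sq
  have hcos : Complex.exp (u * Complex.I) ^ 2 + 1 =
      2 * Complex.cos u * Complex.exp (u * Complex.I) := by
    rw [Complex.exp_mul_I]
    linear_combination Complex.sin u ^ 2 * Complex.I_sq - Complex.sin_sq_add_cos_sq (u : ℂ)
  have hgen := sum_T_mul_pow a b (Complex.exp (u * Complex.I) ^ 2)
  rw [hsin, hcos, hc] at hgen
  refine mul_right_cancel₀ (pow_ne_zero (2 * c) (Complex.exp_ne_zero (u * Complex.I))) ?_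
  calc _ = (2 * Complex.cos u * Complex.exp (u * Complex.I)) ^ b *
        (2 * Complex.I * Complex.sin u * Complex.exp (u * Complex.I)) ^ a := by
        rw [← hc]
        push_cast
        ring
    _ = _ := by
        rw [← hgen, Finset.sum_mul]
        refine Finset.sum_congr rfl fun x _ => ?_
        rw [mul_assoc, ← pow_mul, ← Complex.exp_nat_mul, ← Complex.exp_nat_mul, ← Complex.exp_add]
        congr 2
        push_cast
        ring

/-- For `a, b` odd, with `c = (a+b)/2` and `d = ⌊a/2⌋ = (a−1)/2`:
`sin^a u cos^b u = ((−1)^d/2^{a+b}) Σ_{j=1}^{c} (T_{c+j}(a,b)−T_{c−j}(a,b)) sin(2ju)`. -/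
theorem stmt11 (a b : ℕ) (ha : Odd a) (hb : Odd b) (u : ℝ) :
    Real.sin u ^ a * Real.cos u ^ b =
      ((-1 : ℝ) ^ (a / 2) / 2 ^ (a + b)) *
        ∑ j ∈ Finset.Icc 1 ((a + b) / 2),
          (T ((a + b) / 2 + j) a b - T ((a + b) / 2 - j) a b) *
            Real.sin (2 * (j : ℝ) * u) := by
  obtain ⟨c, hc⟩ := (ha.add_odd hb).two_dvd
  obtain ⟨d, rfl⟩ := ha
  have hd : (2 * d + 1) / 2 = d := by omega
  have hI : Complex.I ^ (2 * d + 1) = ((-1 : ℝ) ^ d : ℝ) * Complex.I := by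
    rw [pow_succ, pow_mul, Complex.I_sq]
    push_cast
    rfl
  have key := congrArg Complex.im (I_pow_mul_sin_pow_mul_cos_pow (2 * d + 1) b c hc u)
  rw [hI, mul_right_comm, ← Complex.ofReal_mul, Complex.im_ofReal_mul, Complex.I_im, mul_one,
    Complex.im_sum] at key
  simp only [Complex.im_ofReal_mul, Complex.exp_ofReal_mul_I_im] at key
  rw [sum_range_two_mul_add_one, sub_self, mul_zero, zero_mul, Real.sin_zero, mul_zero,
    zero_add] at key
  have hsum : ∀ j ∈ Finset.Icc 1 c,
      T (c + j) (2 * d + 1) b * Real.sin (2 * (((c + j : ℕ) : ℝ) - c) * u) +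
        T (c - j) (2 * d + 1) b * Real.sin (2 * (((c - j : ℕ) : ℝ) - c) * u) =
      (T (c + j) (2 * d + 1) b - T (c - j) (2 * d + 1) b) * Real.sin (2 * (j : ℝ) * u) := by
    intro j hj
    rw [Nat.cast_sub (Finset.mem_Icc.mp hj).2, Nat.cast_add,
      show 2 * ((c : ℝ) + j - c) * u = 2 * j * u by ring,
      show 2 * ((c : ℝ) - j - c) * u = -(2 * j * u) by ring, Real.sin_neg]
    ring
  rw [Finset.sum_congr rfl hsum] at key
  rw [hd, show (2 * d + 1 + b) / 2 = c by omega, ← key]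
  have hsq : ((-1 : ℝ) ^ d) * (-1) ^ d = 1 := by rw [← mul_pow]; norm_num
  rw [div_mul_eq_mul_div, eq_div_iff (by positivity), ← mul_assoc, hsq]
  ring
end

section
/- Let m and p be positive integers, and let A(x) = a_0 Π_{j=1}^{p} (x − x_j) be a real polynomial of degree p (a_0 ≠ 0) whose roots x_1, …, x_p (listed with multiplicity) are all non-real. For 0 ≤ l ≤ p define e_l = a_0^m (−1)^l (Π_{j=1}^{p} Q_m(x_j)) · σ_l^{(p)}(R_m(x_1), …, R_m(x_p)), and set E(x) = Σ_{l=0}^{p} e_l P_m(x)^{p−l} Q_m(x)^{l}. Then: (i) every e_l is a real number; (ii) E(x) = a_0^m · Π_{j=1}^{p} ( Q_m(x_j) P_m(x) − P_m(x_j) Q_m(x) ) as polynomials; and (iii) A divides E in ℝ[x]. -/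
open Polynomial

/-- The polynomial `P_m(x) = Σ_{j=0}^{⌊m/2⌋} (−1)^j C(m,2j) x^{m−2j}` in `ℂ[x]`. -/
noncomputable def PmC (m : ℕ) : Polynomial ℂ :=
  ∑ j ∈ Finset.range (m / 2 + 1),
    Polynomial.C ((-1 : ℂ) ^ j * (m.choose (2 * j))) * Polynomial.X ^ (m - 2 * j)

/-- The polynomial `Q_m(x) = Σ_{j=0}^{⌊(m−1)/2⌋} (−1)^j C(m,2j+1) x^{m−2j−1}` in `ℂ[x]`. -/
noncomputable def QmC (m : ℕ) : Polynomial ℂ :=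
  ∑ j ∈ Finset.range ((m - 1) / 2 + 1),
    Polynomial.C ((-1 : ℂ) ^ j * (m.choose (2 * j + 1))) * Polynomial.X ^ (m - (2 * j + 1))

/-- The `l`-th elementary symmetric polynomial `σ_l^{(p)}(y_1, …, y_p)`. -/
noncomputable def esymmFn (p : ℕ) (y : Fin p → ℂ) (l : ℕ) : ℂ :=
  ∑ S ∈ Finset.powersetCard l (Finset.univ : Finset (Fin p)), ∏ j ∈ S, y j

/-- `e_l = a₀^m (−1)^l (Π_j Q_m(x_j)) σ_l^{(p)}(R_m(x_1), …, R_m(x_p))`. -/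
noncomputable def eC (m p : ℕ) (a₀ : ℝ) (x : Fin p → ℂ) (l : ℕ) : ℂ :=
  (a₀ : ℂ) ^ m * (-1) ^ l * (∏ j, (QmC m).eval (x j)) *
    esymmFn p (fun j => (PmC m).eval (x j) / (QmC m).eval (x j)) l

/-- `E(x) = Σ_{l=0}^{p} e_l P_m(x)^{p−l} Q_m(x)^{l}`. -/
noncomputable def Epoly (m p : ℕ) (a₀ : ℝ) (x : Fin p → ℂ) : Polynomial ℂ :=
  ∑ l ∈ Finset.range (p + 1),
    Polynomial.C (eC m p a₀ x l) * (PmC m) ^ (p - l) * (QmC m) ^ l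

theorem Finset.sum_range_two_mul_eq_even_add_odd {M : Type*} [AddCommMonoid M] (f : ℕ → M) (n : ℕ) :
    ∑ k ∈ Finset.range (2 * n), f k =
      ∑ j ∈ Finset.range n, f (2 * j) + ∑ j ∈ Finset.range n, f (2 * j + 1) := by
  induction n with
  | zero => simp
  | succ n ih =>
    rw [show 2 * (n + 1) = 2 * n + 1 + 1 by ring, Finset.sum_range_succ, Finset.sum_range_succ, ih,
      Finset.sum_range_succ, Finset.sum_range_succ]
    abel

theorem Finset.sum_range_succ_eq_even_add_odd {M : Type*} [AddCommMonoid M] (f : ℕ → M) {m : ℕ}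
    (hm : 0 < m) :
    ∑ k ∈ Finset.range (m + 1), f k =
      ∑ j ∈ Finset.range (m / 2 + 1), f (2 * j) +
        ∑ j ∈ Finset.range ((m - 1) / 2 + 1), f (2 * j + 1) := by
  obtain ⟨n, rfl | rfl⟩ := Nat.even_or_odd' m
  · rw [Finset.sum_range_succ, Finset.sum_range_two_mul_eq_even_add_odd,
      show 2 * n / 2 + 1 = n + 1 by omega, show (2 * n - 1) / 2 + 1 = n by omega,
      Finset.sum_range_succ]
    abel
  · rw [show 2 * n + 1 + 1 = 2 * (n + 1) by ring, Finset.sum_range_two_mul_eq_even_add_odd,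
      show (2 * n + 1) / 2 + 1 = n + 1 by omega, show (2 * n + 1 - 1) / 2 + 1 = n + 1 by omega]

/-- `(x + i)^m = P_m(x) + i Q_m(x)`. -/
theorem X_add_C_I_pow {m : ℕ} (hm : 0 < m) :
    (X + C Complex.I) ^ m = PmC m + C Complex.I * QmC m := by
  rw [add_comm X, add_pow, Finset.sum_range_succ_eq_even_add_odd _ hm, PmC, QmC, Finset.mul_sum]
  refine congrArg₂ (· + ·) (Finset.sum_congr rfl fun j _ => ?_) (Finset.sum_congr rfl fun j _ => ?_)
  · rw [pow_mul, ← C_pow, Complex.I_sq]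
    simp only [C_mul, C_pow, C_eq_natCast]
    ring
  · rw [pow_succ, pow_mul, ← C_pow, Complex.I_sq]
    simp only [C_mul, C_pow, C_eq_natCast]
    ring

theorem PmC_map_conj (m : ℕ) : (PmC m).map (starRingEnd ℂ) = PmC m := by
  simp [PmC, Polynomial.map_sum]

theorem QmC_map_conj (m : ℕ) : (QmC m).map (starRingEnd ℂ) = QmC m := by
  simp [QmC, Polynomial.map_sum]

theorem conj_eval_of_map_conj {f : ℂ[X]} (hf : f.map (starRingEnd ℂ) = f) (z : ℂ) :
    starRingEnd ℂ (f.eval z) = f.eval (starRingEnd ℂ z) := by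
  conv_rhs => rw [← hf, eval_map_apply]

/-- `(x - i)^m = P_m(x) - i Q_m(x)`. -/
theorem X_sub_C_I_pow {m : ℕ} (hm : 0 < m) :
    (X - C Complex.I) ^ m = PmC m - C Complex.I * QmC m := by
  have h := congrArg (Polynomial.map (starRingEnd ℂ)) (X_add_C_I_pow hm)
  simpa [PmC_map_conj, QmC_map_conj, sub_eq_add_neg] using h

theorem QmC_eval_ne_zero {m : ℕ} (hm : 0 < m) {z : ℂ} (hz : z.im ≠ 0) :
    (QmC m).eval z ≠ 0 := by
  intro h
  have h₁ : (z + Complex.I) ^ m = (PmC m).eval z := by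
    simpa [h] using congrArg (Polynomial.eval z) (X_add_C_I_pow hm)
  have h₂ : (z - Complex.I) ^ m = (PmC m).eval z := by
    simpa [h] using congrArg (Polynomial.eval z) (X_sub_C_I_pow hm)
  have h₃ : ‖z + Complex.I‖ = ‖z - Complex.I‖ := by
    rw [← pow_left_inj₀ (norm_nonneg _) (norm_nonneg _) hm.ne', ← norm_pow, ← norm_pow, h₁, h₂]
  have h₄ : Complex.normSq (z + Complex.I) = Complex.normSq (z - Complex.I) := by
    rw [Complex.normSq_eq_norm_sq, Complex.normSq_eq_norm_sq, h₃]
  simp only [Complex.normSq_apply, Complex.add_re, Complex.add_im, Complex.sub_re, Complex.sub_im,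
    Complex.I_re, Complex.I_im] at h₄
  apply hz
  linarith

theorem esymmFn_eq_multiset_esymm (p : ℕ) (y : Fin p → ℂ) (l : ℕ) :
    esymmFn p y l = ((Finset.univ : Finset (Fin p)).val.map y).esymm l :=
  (Finset.esymm_map_val y Finset.univ l).symm

theorem eC_congr (m p : ℕ) (a₀ : ℝ) {x y : Fin p → ℂ} (l : ℕ)
    (h : (Finset.univ : Finset (Fin p)).val.map x = (Finset.univ : Finset (Fin p)).val.map y) :
    eC m p a₀ x l = eC m p a₀ y l := by
  have key : ∀ z : Fin p → ℂ, eC m p a₀ z l = (a₀ : ℂ) ^ m * (-1) ^ l *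
      (((Finset.univ : Finset (Fin p)).val.map z).map fun t => (QmC m).eval t).prod *
      (((Finset.univ : Finset (Fin p)).val.map z).map
        fun t => (PmC m).eval t / (QmC m).eval t).esymm l := by
    intro z
    rw [eC, esymmFn_eq_multiset_esymm, Multiset.map_map, Multiset.map_map]
    rfl
  rw [key, key, h]

theorem conj_eC (m p : ℕ) (a₀ : ℝ) (x : Fin p → ℂ) (l : ℕ) :
    starRingEnd ℂ (eC m p a₀ x l) = eC m p a₀ (fun j => starRingEnd ℂ (x j)) l := by
  simp [eC, esymmFn, map_sum, map_prod, conj_eval_of_map_conj (PmC_map_conj m),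
    conj_eval_of_map_conj (QmC_map_conj m)]

theorem roots_C_mul_prod_X_sub_C {p : ℕ} {a : ℂ} (ha : a ≠ 0) (x : Fin p → ℂ) :
    (C a * ∏ j, (X - C (x j))).roots = (Finset.univ : Finset (Fin p)).val.map x := by
  rw [roots_C_mul _ ha, ← roots_multiset_prod_X_sub_C (Finset.univ.val.map x), Multiset.map_map]
  rfl

/-- The roots of a real polynomial are permuted by complex conjugation. -/
theorem map_conj_roots_eq {p : ℕ} {a₀ : ℝ} (h0 : a₀ ≠ 0) {x : Fin p → ℂ} {A : ℝ[X]}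
    (hA : A.map (algebraMap ℝ ℂ) = C (a₀ : ℂ) * ∏ j, (X - C (x j))) :
    (Finset.univ : Finset (Fin p)).val.map (fun j => starRingEnd ℂ (x j)) =
      (Finset.univ : Finset (Fin p)).val.map x := by
  have h0' : (a₀ : ℂ) ≠ 0 := by exact_mod_cast h0
  have hconj : (A.map (algebraMap ℝ ℂ)).map (starRingEnd ℂ) = A.map (algebraMap ℝ ℂ) := by
    rw [Polynomial.map_map]
    congr 1
    ext r
    simp
  rw [hA] at hconj
  simp only [Polynomial.map_mul, Polynomial.map_prod, Polynomial.map_sub, map_C, map_X,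
    Complex.conj_ofReal] at hconj
  rw [← roots_C_mul_prod_X_sub_C h0', ← roots_C_mul_prod_X_sub_C h0', hconj]

theorem prod_mul_sub_mul_eq_sum {p : ℕ} (q r : Fin p → ℂ) (hq : ∀ j, q j ≠ 0) (P Q : ℂ[X]) :
    ∏ j, (C (q j) * P - C (r j) * Q) =
      ∑ l ∈ Finset.range (p + 1),
        C ((-1) ^ l * (∏ j, q j) * esymmFn p (fun j => r j / q j) l) * P ^ (p - l) * Q ^ l := by
  have hfac : ∀ j, C (q j) * P - C (r j) * Q = C (q j) * (C (-(r j / q j)) * Q + P) := by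
    intro j
    have : r j = q j * (r j / q j) := by field_simp [hq j]
    conv_lhs => rw [this]
    simp only [C_mul, C_neg]
    ring
  simp_rw [hfac]
  rw [Finset.prod_mul_distrib, Finset.prod_add, Finset.sum_powerset, Finset.card_univ,
    Fintype.card_fin, Finset.mul_sum]
  refine Finset.sum_congr rfl fun l _ => ?_
  rw [esymmFn, Finset.mul_sum, Finset.mul_sum, map_sum, Finset.sum_mul, Finset.sum_mul]
  refine Finset.sum_congr rfl fun S hS => ?_
  have hc := (Finset.mem_powersetCard.1 hS).2
  rw [Finset.prod_mul_distrib, Finset.prod_const, Finset.prod_const,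
    Finset.card_sdiff_of_subset (Finset.subset_univ S), Finset.card_univ, Fintype.card_fin, hc,
    ← map_prod, ← map_prod, Finset.prod_neg, hc]
  simp only [C_mul, C_pow]
  ring

theorem exists_real_of_map_conj_eq {f : ℂ[X]} (hf : f.map (starRingEnd ℂ) = f) :
    ∃ g : ℝ[X], g.map (algebraMap ℝ ℂ) = f := by
  refine (mem_lifts f).1 ((lifts_iff_coeff_lifts f).2 fun n => ?_)
  have h : starRingEnd ℂ (f.coeff n) = f.coeff n := by rw [← coeff_map, hf]
  obtain ⟨r, hr⟩ := Complex.conj_eq_iff_real.1 h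
  exact ⟨r, hr.symm⟩

/-- For `A = a₀ Π_j (x − x_j)` real of degree `p` with all roots non-real:
(i) every `e_l` is real; (ii) `E = a₀^m Π_j (Q_m(x_j) P_m − P_m(x_j) Q_m)`;
(iii) `A` divides `E` in `ℝ[x]` (i.e. `E` is the complexification of a real
polynomial divisible by `A`). -/
theorem stmt17 (m p : ℕ) (hm : 0 < m) (hp : 0 < p) (a₀ : ℝ) (h0 : a₀ ≠ 0)
    (x : Fin p → ℂ) (hx : ∀ j, (x j).im ≠ 0) (A : Polynomial ℝ)
    (hA : A.map (algebraMap ℝ ℂ) =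
      Polynomial.C (a₀ : ℂ) * ∏ j, (Polynomial.X - Polynomial.C (x j))) :
    (∀ l ∈ Finset.range (p + 1), (eC m p a₀ x l).im = 0) ∧
      Epoly m p a₀ x = Polynomial.C ((a₀ : ℂ) ^ m) *
        ∏ j, (Polynomial.C ((QmC m).eval (x j)) * PmC m -
              Polynomial.C ((PmC m).eval (x j)) * QmC m) ∧
      ∃ Er : Polynomial ℝ,
        Er.map (algebraMap ℝ ℂ) = Epoly m p a₀ x ∧ A ∣ Er := by
  have hE : Epoly m p a₀ x = C ((a₀ : ℂ) ^ m) *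
      ∏ j, (C ((QmC m).eval (x j)) * PmC m - C ((PmC m).eval (x j)) * QmC m) := by
    rw [prod_mul_sub_mul_eq_sum _ _ fun j => QmC_eval_ne_zero hm (hx j), Epoly, Finset.mul_sum]
    refine Finset.sum_congr rfl fun l _ => ?_
    simp only [eC, C_mul]
    ring
  have hreal : ∀ l, starRingEnd ℂ (eC m p a₀ x l) = eC m p a₀ x l := fun l => by
    rw [conj_eC, eC_congr m p a₀ l (map_conj_roots_eq h0 hA)]
  refine ⟨fun l _ => Complex.conj_eq_iff_im.1 (hreal l), hE, ?_⟩
  obtain ⟨Er, hEr⟩ := exists_real_of_map_conj_eq (f := Epoly m p a₀ x) <| by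
    simp [Epoly, Polynomial.map_sum, hreal, PmC_map_conj, QmC_map_conj]
  refine ⟨Er, hEr, (Polynomial.map_dvd_map' (algebraMap ℝ ℂ)).1 ?_⟩
  rw [hEr, hE, hA]
  refine mul_dvd_mul (map_dvd C (dvd_pow_self _ hm.ne')) (Finset.prod_dvd_prod_of_dvd _ _ ?_)
  intro j _
  rw [dvd_iff_isRoot, IsRoot.def]
  simp [mul_comm]
end
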